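/- Let T be the simple graph whose vertices are the finite binary strings (elements of 2^{<ω}) and whose edges join each string s to its one-bit extensions s0 and s1. Then T admits no well-ordered depth-first traversal. -/

import Mathlib

/-- `S` is an initial segment (downward-closed set) of the order `r`. -/
def IsInitialSeg {V : Type*} (r : V → V → Prop) (S : Set V) : Prop :=
  ∀ ⦃a b : V⦄, r a b → b ∈ S → a ∈ S

/-- `r` is a traversal of `G`: every nonempty initial segment of `r` induces a
connected subgraph of `G`. -/
def IsTraversal {V : Type*} (G : SimpleGraph V) (r : V → V → Prop) : Prop :=
  ∀ S : Set V, IsInitialSeg r S → S.Nonempty → (G.induce S).Connected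

/-- A traversal `r` of `G` is depth-first if whenever `u < v < w`, `u` is adjacent
to `w` and `u` is not adjacent to `v`, there is `x` with `u < x < v` adjacent to `v`. -/
def IsDepthFirst {V : Type*} (G : SimpleGraph V) (r : V → V → Prop) : Prop :=
  ∀ u v w : V, r u v → r v w → G.Adj u w → ¬ G.Adj u v →
    ∃ x : V, r u x ∧ r x v ∧ G.Adj x v

/-- The complete infinite binary tree of depth `ω`: vertices are finite binary
strings, and each string `s` is joined to its one-bit extensions `s0` and `s1`. -/
def binaryTree : SimpleGraph (List Bool) :=
  SimpleGraph.fromRel (fun s t => ∃ b : Bool, t = s ++ [b])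

theorem binaryTree_adj_iff {s t : List Bool} :
    binaryTree.Adj s t ↔ (∃ b, t = s ++ [b]) ∨ ∃ b, s = t ++ [b] := by
  simp only [binaryTree, SimpleGraph.fromRel_adj, and_iff_right_iff_imp]
  rintro (⟨b, rfl⟩ | ⟨b, rfl⟩) <;> simp

theorem binaryTree_adj_append (s : List Bool) (b : Bool) : binaryTree.Adj s (s ++ [b]) :=
  binaryTree_adj_iff.2 (Or.inl ⟨b, rfl⟩)

/-- Away from `v`, the edges of the binary tree do not leave the subtree above `v ++ [b]`. -/
theorem binaryTree_prefix_of_adj {v s t : List Bool} {b : Bool} (ht : t ≠ v)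
    (h : binaryTree.Adj s t) (hs : v ++ [b] <+: s) : v ++ [b] <+: t := by
  rcases binaryTree_adj_iff.1 h with ⟨c, rfl⟩ | ⟨c, rfl⟩
  · exact hs.trans (List.prefix_append _ _)
  · rcases List.prefix_concat_iff.1 hs with h' | h'
    · exact absurd (List.append_inj_left' h' rfl).symm ht
    · exact h'

theorem binaryTree_prefix_of_connected {S : Set (List Bool)} {v y : List Bool} {b : Bool}
    (hS : (binaryTree.induce S).Connected) (hv : v ∉ S) (hx : v ++ [b] ∈ S) (hy : y ∈ S) :
    v ++ [b] <+: y := by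
  obtain ⟨p⟩ := hS.preconnected ⟨y, hy⟩ ⟨v ++ [b], hx⟩
  suffices ∀ (a c : S), (binaryTree.induce S).Walk a c → v ++ [b] <+: c.1 → v ++ [b] <+: a.1 from
    this _ _ p List.prefix_rfl
  intro a c q hc
  induction q with
  | nil => exact hc
  | @cons a d _ h _ ih =>
    exact binaryTree_prefix_of_adj (fun e => hv (e ▸ a.2)) (SimpleGraph.Adj.symm h) (ih hc)

/-- Two neighbours of `v` lying in a connected set that avoids `v` coincide. -/
theorem binaryTree_eq_of_adj_of_connected {S : Set (List Bool)} {v x y : List Bool}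
    (hS : (binaryTree.induce S).Connected) (hv : v ∉ S) (hx : x ∈ S) (hy : y ∈ S)
    (hvx : binaryTree.Adj v x) (hvy : binaryTree.Adj v y) : x = y := by
  rcases binaryTree_adj_iff.1 hvx with ⟨b, rfl⟩ | ⟨b, hb⟩
  · have h := binaryTree_prefix_of_connected hS hv hx hy
    rcases binaryTree_adj_iff.1 hvy with ⟨c, rfl⟩ | ⟨c, rfl⟩
    · exact h.eq_of_length (by simp)
    · have := h.length_le
      simp at this
  · rcases binaryTree_adj_iff.1 hvy with ⟨c, rfl⟩ | ⟨c, hc⟩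
    · have h := (binaryTree_prefix_of_connected hS hv hy hx).length_le
      simp [hb] at h
    · exact List.append_inj_left' (hb.symm.trans hc) rfl

theorem IsTraversal.binaryTree_eq_of_adj {r : List Bool → List Bool → Prop}
    [IsWellOrder (List Bool) r] (hr : IsTraversal binaryTree r) {v x y : List Bool}
    (hx : r x v) (hy : r y v) (hvx : binaryTree.Adj v x) (hvy : binaryTree.Adj v y) : x = y :=
  binaryTree_eq_of_adj_of_connected (S := {z | r z v})
    (hr _ (fun _ _ hab hb => _root_.trans (r := r) hab hb) ⟨x, hx⟩) (irrefl v) hx hy hvx hvy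

theorem IsTraversal.binaryTree_exists_later {r : List Bool → List Bool → Prop}
    [IsWellOrder (List Bool) r] (hr : IsTraversal binaryTree r) (v : List Bool) :
    ∃ e, r v e ∧ binaryTree.Adj v e := by
  by_contra! h
  have key : ∀ b, r (v ++ [b]) v := fun b => by
    rcases trichotomous_of r (v ++ [b]) v with h' | h' | h'
    · exact h'
    · simp at h'
    · exact absurd (binaryTree_adj_append v b) (h _ h')
  simpa using hr.binaryTree_eq_of_adj (key true) (key false) (binaryTree_adj_append v _)
    (binaryTree_adj_append v _)

theorem IsTraversal.binaryTree_exists_two_later {r : List Bool → List Bool → Prop}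
    [IsWellOrder (List Bool) r] (hr : IsTraversal binaryTree r) {v : List Bool} (hv : v ≠ []) :
    ∃ e f, r v e ∧ r e f ∧ binaryTree.Adj v e ∧ binaryTree.Adj v f := by
  obtain ⟨p, b, rfl⟩ := (List.eq_nil_or_concat' v).resolve_left hv
  have hp : binaryTree.Adj (p ++ [b]) p := (binaryTree_adj_append p b).symm
  have ht := binaryTree_adj_append (p ++ [b]) true
  have hf := binaryTree_adj_append (p ++ [b]) false
  have hpt : p ≠ p ++ [b] ++ [true] := by simp
  have hpf : p ≠ p ++ [b] ++ [false] := by simp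
  have htf : p ++ [b] ++ [true] ≠ p ++ [b] ++ [false] := by simp
  generalize p ++ [b] ++ [true] = t at *
  generalize p ++ [b] ++ [false] = f at *
  generalize p ++ [b] = v at *
  have two : ∀ x y, x ≠ y → binaryTree.Adj v x → binaryTree.Adj v y → r v x → r v y →
      ∃ e f, r v e ∧ r e f ∧ binaryTree.Adj v e ∧ binaryTree.Adj v f := by
    intro x y hxy hx hy hvx hvy
    rcases trichotomous_of r x y with h | h | h
    · exact ⟨x, y, hvx, h, hx, hy⟩
    · exact absurd h hxy
    · exact ⟨y, x, hvy, h, hy, hx⟩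
  have side : ∀ x, binaryTree.Adj v x → r v x ∨ r x v := by
    intro x hx
    rcases trichotomous_of r v x with h | h | h
    · exact Or.inl h
    · exact absurd h hx.ne
    · exact Or.inr h
  rcases side p hp with h1 | h1 <;> rcases side t ht with h2 | h2 <;>
    rcases side f hf with h3 | h3
  · exact two _ _ hpt hp ht h1 h2
  · exact two _ _ hpt hp ht h1 h2
  · exact two _ _ hpf hp hf h1 h3
  · exact absurd (hr.binaryTree_eq_of_adj h2 h3 ht hf) htf
  · exact two _ _ htf ht hf h2 h3
  · exact absurd (hr.binaryTree_eq_of_adj h1 h3 hp hf) hpf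
  · exact absurd (hr.binaryTree_eq_of_adj h1 h2 hp ht) hpt
  · exact absurd (hr.binaryTree_eq_of_adj h1 h2 hp ht) hpt

/-- If `w` is discovered from `u`, then every neighbour of a vertex `d` lying strictly
between `u` and `w` comes before `w`. -/
theorem IsDepthFirst.binaryTree_lt {r : List Bool → List Bool → Prop}
    [IsWellOrder (List Bool) r] (hr : IsTraversal binaryTree r) (hd : IsDepthFirst binaryTree r)
    {u d w e : List Bool} (hud : r u d) (hdw : r d w) (huw : binaryTree.Adj u w)
    (hade : binaryTree.Adj d e) : r e w := by
  have huw' : r u w := Trans.trans hud hdw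
  have hnot : ∀ x, r u x → r x w → ¬ binaryTree.Adj x w := fun x hux hxw h => by
    obtain rfl := hr.binaryTree_eq_of_adj hxw huw' h.symm huw.symm
    exact irrefl _ hux
  rcases trichotomous_of r e w with h | rfl | h
  · exact h
  · exact absurd hade (hnot d hud hdw)
  · obtain ⟨x, hdx, hxw, hx⟩ := hd d w e hdw h hade (hnot d hud hdw)
    exact absurd hx (hnot x (Trans.trans hud hdx) hxw)

/-- The complete infinite binary tree admits no well-ordered depth-first traversal. -/
theorem binaryTree_no_wellordered_depthFirst_traversal :
    ¬ ∃ r : List Bool → List Bool → Prop,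
      IsWellOrder (List Bool) r ∧ IsTraversal binaryTree r ∧ IsDepthFirst binaryTree r := by
  rintro ⟨r, _, hr, hd⟩
  let P : Set (List Bool) :=
    {w | ∃ u c, r u c ∧ r c w ∧ binaryTree.Adj u c ∧ binaryTree.Adj u w}
  have hP : P.Nonempty := by
    obtain ⟨e, f, h⟩ := hr.binaryTree_exists_two_later (List.cons_ne_nil true [])
    exact ⟨f, [true], e, h⟩
  obtain ⟨w, ⟨u, c, huc, hcw, hauc, hauw⟩, hmin⟩ :=
    (IsWellFounded.wf (r := r)).has_min P hP
  have key : ∀ d, r u d → r d w → d = [] := by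
    intro d hud hdw
    by_contra hne
    obtain ⟨e, f, hde, hef, hade, hadf⟩ := hr.binaryTree_exists_two_later hne
    exact hmin f ⟨d, e, hde, hef, hade, hadf⟩
      (hd.binaryTree_lt hr hud hdw hauw hadf)
  obtain ⟨d, hcd, hacd⟩ := hr.binaryTree_exists_later c
  exact hacd.ne ((key c huc hcw).trans
    (key d (Trans.trans huc hcd) (hd.binaryTree_lt hr huc hcw hauw hacd)).symm)
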